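/- arXiv:2411.01482 — 3 statements merged into one kernel-verified Lean document; each statement's English description precedes it below -/
import Mathlib

section
/- Let d ≥ 1, let K ⊂ ℝ^d be an open convex body with B(o,1/(2d)) ⊂ K ⊂ B(o,1/2), and let δ ∈ (0,1/2] be such that K_δ ≠ ∅ and o ∉ K_δ. Then every x ∈ K_δ satisfies dist(x, ∂K) > 2√3·ω_d/(2d)^{d+3}. -/
open MeasureTheory Metric Bornology
open scoped InnerProductSpace Pointwise

noncomputable def halfspaceDepth {d : ℕ} (K : Set (EuclideanSpace ℝ (Fin d)))
    (q : EuclideanSpace ℝ (Fin d)) : ℝ :=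
  ⨅ v : {v : EuclideanSpace ℝ (Fin d) // ‖v‖ = 1},
    (volume {z : EuclideanSpace ℝ (Fin d) | z ∈ K ∧ 0 ≤ ⟪(v : EuclideanSpace ℝ (Fin d)), z - q⟫_ℝ}).toReal
      / (volume K).toReal

def depthRegion {d : ℕ} (K : Set (EuclideanSpace ℝ (Fin d))) (δ : ℝ) :
    Set (EuclideanSpace ℝ (Fin d)) :=
  {q | δ ≤ halfspaceDepth K q}

noncomputable def hilbertDist {d : ℕ} (K : Set (EuclideanSpace ℝ (Fin d)))
    (p q : EuclideanSpace ℝ (Fin d)) : ℝ :=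
  sInf {r : ℝ | (p = q ∧ r = 0) ∨
    ∃ a b : EuclideanSpace ℝ (Fin d), a ∈ frontier K ∧ b ∈ frontier K ∧
      (∃ t : ℝ, t < 0 ∧ a = p + t • (q - p)) ∧
      (∃ s : ℝ, 1 < s ∧ b = p + s • (q - p)) ∧
      r = (1 / 2) * Real.log ((‖q - a‖ * ‖p - b‖) / (‖p - a‖ * ‖q - b‖))}

def hilbertBall {d : ℕ} (K : Set (EuclideanSpace ℝ (Fin d)))
    (x : EuclideanSpace ℝ (Fin d)) (r : ℝ) : Set (EuclideanSpace ℝ (Fin d)) :=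
  {y | 0 < r ∧ y ∈ K ∧ hilbertDist K x y < r}

noncomputable def omegaBall (d : ℕ) : ℝ :=
  (volume (Metric.ball (0 : EuclideanSpace ℝ (Fin d)) 1)).toReal

def dilate {d : ℕ} (lam : ℝ) (K : Set (EuclideanSpace ℝ (Fin d))) :
    Set (EuclideanSpace ℝ (Fin d)) :=
  {y | 0 < lam ∧ y ∈ lam • K}


/-- The part of a ball of radius `1 / 2` lying between two parallel hyperplanes has volume at most
the distance between the hyperplanes. -/
theorem volume_ball_half_inter_slab_le {d : ℕ} (v : EuclideanSpace ℝ (Fin d)) (hv : ‖v‖ = 1)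
    (a b : ℝ) :
    volume {z : EuclideanSpace ℝ (Fin d) |
      z ∈ ball (0 : EuclideanSpace ℝ (Fin d)) (1 / 2) ∧ a ≤ ⟪v, z⟫_ℝ ∧ ⟪v, z⟫_ℝ < b}
      ≤ ENNReal.ofReal (b - a) := by
  have hd : 0 < d := by
    rcases Nat.eq_zero_or_pos d with rfl | h
    · simp [Subsingleton.elim v 0] at hv
    · exact h
  let i₀ : Fin d := ⟨0, hd⟩
  obtain ⟨e, he⟩ := Orthonormal.exists_orthonormalBasis_extension_of_card_eq
    (𝕜 := ℝ) (E := EuclideanSpace ℝ (Fin d)) (ι := Fin d) (by simp) (v := fun _ => v) (s := {i₀})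
    (by
      rw [orthonormal_iff_ite]
      rintro ⟨i, hi⟩ ⟨j, hj⟩
      simp only [Set.mem_singleton_iff] at hi hj
      subst hi hj
      simp [hv])
  have he0 : e i₀ = v := he i₀ rfl
  let φ : EuclideanSpace ℝ (Fin d) → (Fin d → ℝ) := fun z => WithLp.ofLp (e.repr z)
  have hφ : MeasurePreserving φ :=
    (PiLp.volume_preserving_ofLp (Fin d)).comp e.measurePreserving_repr
  let box : Fin d → Set ℝ := fun i => if i = i₀ then Set.Ico a b else Set.Ioo (-(1 / 2)) (1 / 2)
  have hbox : MeasurableSet (Set.univ.pi box) := by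
    refine MeasurableSet.univ_pi fun i => ?_
    by_cases h : i = i₀
    · simp only [box, if_pos h]; exact measurableSet_Ico
    · simp only [box, if_neg h]; exact measurableSet_Ioo
  calc _ ≤ volume (φ ⁻¹' Set.univ.pi box) := by
        refine measure_mono ?_
        rintro z ⟨hz, hza, hzb⟩ i -
        have hφi : φ z i = ⟪e i, z⟫_ℝ := e.repr_apply_apply z i
        by_cases h : i = i₀
        · subst h
          simp only [box, if_true]
          rw [hφi, he0]
          exact ⟨hza, hzb⟩
        · simp only [box, if_neg h]
          rw [hφi]
          have h1 : |⟪e i, z⟫_ℝ| ≤ ‖e i‖ * ‖z‖ := abs_real_inner_le_norm _ _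
          rw [e.norm_eq_one, one_mul] at h1
          exact abs_lt.1 (h1.trans_lt (mem_ball_zero_iff.1 hz))
    _ = volume (Set.univ.pi box) := hφ.measure_preimage hbox.nullMeasurableSet
    _ = ∏ i, volume (box i) := volume_pi_pi _
    _ = volume (box i₀) := by
        refine Finset.prod_eq_single_of_mem i₀ (Finset.mem_univ _) fun i _ h => ?_
        simp only [box, if_neg h, Real.volume_Ioo]
        norm_num
    _ = ENNReal.ofReal (b - a) := by simp [box]

/-- A closed halfspace through the origin contains at least half of every ball centered there. -/
theorem volume_ball_le_two_mul_volume_halfspace {d : ℕ} (K : Set (EuclideanSpace ℝ (Fin d)))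
    (r : ℝ) (hK : ball (0 : EuclideanSpace ℝ (Fin d)) r ⊆ K) (v : EuclideanSpace ℝ (Fin d)) :
    volume (ball (0 : EuclideanSpace ℝ (Fin d)) r) ≤
      2 * volume {z : EuclideanSpace ℝ (Fin d) | z ∈ K ∧ 0 ≤ ⟪v, z - 0⟫_ℝ} := by
  set H := {z : EuclideanSpace ℝ (Fin d) | z ∈ K ∧ 0 ≤ ⟪v, z - 0⟫_ℝ}
  have hsub : ball (0 : EuclideanSpace ℝ (Fin d)) r ⊆ H ∪ -H := by
    intro z hz
    rcases le_total 0 ⟪v, z⟫_ℝ with h | h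
    · exact Or.inl ⟨hK hz, by simpa using h⟩
    · exact Or.inr ⟨hK (by simpa using hz), by simpa using h⟩
  calc _ ≤ volume (H ∪ -H) := measure_mono hsub
    _ ≤ volume H + volume (-H) := measure_union_le _ _
    _ = 2 * volume H := by rw [Measure.measure_neg, two_mul]

/-- The halfspace depth with respect to a subset of `B(0, 1 / 2)`, times the volume of that subset,
is at most the distance to any point that can be separated from the subset. -/
theorem halfspaceDepth_mul_volume_le_dist {d : ℕ} {K : Set (EuclideanSpace ℝ (Fin d))}
    (hKne : K.Nonempty) (hKopen : IsOpen K) (hKconv : Convex ℝ K)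
    (hK12 : K ⊆ ball (0 : EuclideanSpace ℝ (Fin d)) (1 / 2))
    (x y : EuclideanSpace ℝ (Fin d)) (hy : y ∉ K) :
    halfspaceDepth K x * (volume K).toReal ≤ dist x y := by
  have hfin : volume K ≠ ⊤ := ((measure_mono hK12).trans_lt measure_ball_lt_top).ne
  have hpos : 0 < (volume K).toReal := ENNReal.toReal_pos (hKopen.measure_pos _ hKne).ne' hfin
  obtain ⟨f, hf⟩ := geometric_hahn_banach_open_point hKconv hKopen hy
  set w := (InnerProductSpace.toDual ℝ (EuclideanSpace ℝ (Fin d))).symm f with hw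
  have hfw : ∀ z, ⟪w, z⟫_ℝ = f z := fun z => InnerProductSpace.toDual_symm_apply
  obtain ⟨p, hp⟩ := hKne
  have hw0 : w ≠ 0 := by
    intro h
    have := hf p hp
    rw [← hfw, ← hfw, h] at this
    simp at this
  have hwn : 0 < ‖w‖ := norm_pos_iff.2 hw0
  set v := ‖w‖⁻¹ • w
  have hv : ‖v‖ = 1 := norm_smul_inv_norm (𝕜 := ℝ) hw0
  have hvlt : ∀ z ∈ K, ⟪v, z⟫_ℝ < ⟪v, y⟫_ℝ := by
    intro z hz
    simp only [v, real_inner_smul_left, hfw]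
    exact mul_lt_mul_of_pos_left (hf z hz) (inv_pos.2 hwn)
  have hvol : volume {z : EuclideanSpace ℝ (Fin d) | z ∈ K ∧ 0 ≤ ⟪v, z - x⟫_ℝ}
      ≤ ENNReal.ofReal (dist x y) := by
    calc _ ≤ _ := measure_mono ?_
      _ ≤ ENNReal.ofReal (⟪v, y⟫_ℝ - ⟪v, x⟫_ℝ) := volume_ball_half_inter_slab_le v hv _ _
      _ ≤ _ := ENNReal.ofReal_le_ofReal ?_
    · rintro z ⟨hz, h⟩
      rw [inner_sub_right, sub_nonneg] at h
      exact ⟨hK12 hz, h, hvlt z hz⟩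
    · rw [← inner_sub_right, dist_comm, dist_eq_norm]
      simpa [hv] using real_inner_le_norm v (y - x)
  have hdepth : halfspaceDepth K x ≤
      (volume {z : EuclideanSpace ℝ (Fin d) | z ∈ K ∧ 0 ≤ ⟪v, z - x⟫_ℝ}).toReal
        / (volume K).toReal :=
    ciInf_le (f := fun v : {v : EuclideanSpace ℝ (Fin d) // ‖v‖ = 1} =>
      (volume {z : EuclideanSpace ℝ (Fin d) |
        z ∈ K ∧ 0 ≤ ⟪(v : EuclideanSpace ℝ (Fin d)), z - x⟫_ℝ}).toReal / (volume K).toReal)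
      ⟨0, by rintro _ ⟨u, rfl⟩; positivity⟩ ⟨v, hv⟩
  exact ((le_div_iff₀ hpos).1 hdepth).trans (ENNReal.toReal_le_of_le_ofReal dist_nonneg hvol)

/-- The halfspace depth of the center of a ball of radius `r` contained in the body. -/
theorem omegaBall_mul_pow_le_halfspaceDepth_zero {d : ℕ} (hd : 1 ≤ d)
    {K : Set (EuclideanSpace ℝ (Fin d))} (hfin : volume K ≠ ⊤) (hpos : 0 < (volume K).toReal)
    {r : ℝ} (hr : 0 ≤ r) (hK : ball (0 : EuclideanSpace ℝ (Fin d)) r ⊆ K) :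
    r ^ d * omegaBall d / 2 ≤ halfspaceDepth K 0 * (volume K).toReal := by
  have hball : (volume (ball (0 : EuclideanSpace ℝ (Fin d)) r)).toReal = r ^ d * omegaBall d := by
    have : Nonempty (Fin d) := ⟨⟨0, hd⟩⟩
    rw [Measure.addHaar_ball volume 0 hr, ENNReal.toReal_mul, finrank_euclideanSpace_fin,
      ENNReal.toReal_ofReal (by positivity), omegaBall]
  have : Nonempty {v : EuclideanSpace ℝ (Fin d) // ‖v‖ = 1} :=
    ⟨⟨EuclideanSpace.single ⟨0, hd⟩ 1, by simp⟩⟩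
  rw [← div_le_iff₀ hpos]
  refine le_ciInf fun v => div_le_div_of_nonneg_right ?_ hpos.le
  have h := volume_ball_le_two_mul_volume_halfspace K r hK v
  have hHfin : volume {z : EuclideanSpace ℝ (Fin d) |
      z ∈ K ∧ 0 ≤ ⟪(v : EuclideanSpace ℝ (Fin d)), z - 0⟫_ℝ} ≠ ⊤ :=
    ne_top_of_le_ne_top hfin (measure_mono fun z hz => hz.1)
  have h2 := ENNReal.toReal_mono (ENNReal.mul_ne_top (by simp) hHfin) h
  rw [hball, ENNReal.toReal_mul, ENNReal.toReal_ofNat] at h2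
  linarith

theorem stmt13 {d : ℕ} (hd : 1 ≤ d) (K : Set (EuclideanSpace ℝ (Fin d)))
    (hKne : K.Nonempty) (hKopen : IsOpen K) (hKbdd : IsBounded K) (hKconv : Convex ℝ K)
    (hKin : ball (0 : EuclideanSpace ℝ (Fin d)) (1 / (2 * d)) ⊆ K)
    (hK12 : K ⊆ ball (0 : EuclideanSpace ℝ (Fin d)) (1 / 2))
    (δ : ℝ) (hδ0 : 0 < δ) (hδ1 : δ ≤ 1 / 2)
    (hne : (depthRegion K δ).Nonempty)
    (ho : (0 : EuclideanSpace ℝ (Fin d)) ∉ depthRegion K δ) :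
    ∀ x ∈ depthRegion K δ,
      2 * Real.sqrt 3 * omegaBall d / (2 * d) ^ (d + 3) < Metric.infDist x (frontier K) := by
  intro x hx
  have hfin : volume K ≠ ⊤ := hKbdd.measure_lt_top.ne
  have hpos : 0 < (volume K).toReal := ENNReal.toReal_pos (hKopen.measure_pos _ hKne).ne' hfin
  have hd' : (1 : ℝ) ≤ d := by exact_mod_cast hd
  have hω : 0 ≤ omegaBall d := ENNReal.toReal_nonneg
  have hfr : (frontier K).Nonempty := by
    rw [nonempty_frontier_iff]
    refine ⟨hKne, fun h => ?_⟩
    have hmem : EuclideanSpace.single (⟨0, hd⟩ : Fin d) (1 : ℝ) ∈ K := h ▸ Set.mem_univ _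
    have := mem_ball_zero_iff.1 (hK12 hmem)
    norm_num at this
  have hlow := omegaBall_mul_pow_le_halfspaceDepth_zero hd hfin hpos (by positivity) hKin
  have hlt : halfspaceDepth K 0 < δ := not_le.1 ho
  have hup : δ * (volume K).toReal ≤ infDist x (frontier K) := by
    refine (le_infDist hfr).2 fun y hy => ?_
    have hyK : y ∉ K := by
      rw [hKopen.frontier_eq] at hy
      exact hy.2
    exact (mul_le_mul_of_nonneg_right hx hpos.le).trans
      (halfspaceDepth_mul_volume_le_dist hKne hKopen hKconv hK12 x y hyK)
  refine lt_of_le_of_lt (le_trans ?_ hlow) ((mul_lt_mul_of_pos_right hlt hpos).trans_le hup)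
  have h3 : Real.sqrt 3 ≤ 2 := by
    rw [Real.sqrt_le_left (by norm_num)]
    norm_num
  have hd3 : (1 : ℝ) ≤ (d : ℝ) ^ 3 := one_le_pow₀ hd'
  rw [div_le_iff₀ (by positivity), one_div, inv_pow, pow_add]
  have hp : (0 : ℝ) < (2 * (d : ℝ)) ^ d := by positivity
  have heq : ((2 * (d : ℝ)) ^ d)⁻¹ * omegaBall d / 2 * ((2 * (d : ℝ)) ^ d * (2 * (d : ℝ)) ^ 3)
      = 4 * (d : ℝ) ^ 3 * omegaBall d := by
    field_simp
    ring
  rw [heq]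
  exact mul_le_mul_of_nonneg_right (by linarith) hω
end

section
/- Let K ⊂ ℝ² be a nonempty bounded open convex polygon (a bounded nonempty intersection of finitely many open halfplanes) and let q ∈ K. Then there exists a line ℓ through q such that q is the midpoint of the chord K ∩ ℓ (i.e., the two points where ℓ meets ∂K are symmetric about q) and one of the two closed halfplanes H₊ bounded by ℓ satisfies |K ∩ H₊| = D_K(q)·|K|. -/
open MeasureTheory Metric Bornology
open scoped InnerProductSpace Pointwise

/-- A hyperplane is Lebesgue null. -/
lemma volume_inner_sub_eq_zero {E : Type*} [NormedAddCommGroup E] [InnerProductSpace ℝ E]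
    [FiniteDimensional ℝ E] [MeasurableSpace E] [BorelSpace E] {u : E} (hu : u ≠ 0) (q : E) :
    volume {z : E | ⟪u, z - q⟫_ℝ = 0} = 0 := by
  have h0 : volume ((LinearMap.ker (innerₛₗ ℝ u) : Submodule ℝ E) : Set E) = 0 := by
    refine Measure.addHaar_submodule _ _ fun h ↦ hu ?_
    have : u ∈ LinearMap.ker (innerₛₗ ℝ u) := h ▸ Submodule.mem_top
    simpa using this
  have h1 := (measurePreserving_sub_right (volume : Measure E) q).measure_preimage
    (LinearMap.ker (innerₛₗ ℝ u)).closed_of_finiteDimensional.measurableSet.nullMeasurableSet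
  rw [h0] at h1
  convert h1 using 2
  ext z
  simp

lemma measurableSet_inner_nonneg {E : Type*} [NormedAddCommGroup E] [InnerProductSpace ℝ E]
    [MeasurableSpace E] [BorelSpace E] (u q : E) : MeasurableSet {z : E | 0 ≤ ⟪u, z - q⟫_ℝ} :=
  (isClosed_le continuous_const (by fun_prop)).measurableSet

/-- The area cut off from a set of finite measure by a halfspace through `q` depends continuously
on the nonzero inner normal of the halfspace. -/
lemma continuousAt_volume_inter_halfspace {E : Type*} [NormedAddCommGroup E]
    [InnerProductSpace ℝ E] [FiniteDimensional ℝ E] [MeasurableSpace E] [BorelSpace E] {K : Set E}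
    (hKm : MeasurableSet K) (hKfin : volume K ≠ ⊤) (q : E) {u : E} (hu : u ≠ 0) :
    ContinuousAt (fun v ↦ volume (K ∩ {z : E | 0 ≤ ⟪v, z - q⟫_ℝ})) u := by
  refine tendsto_measure_of_ae_tendsto_indicator (nhds u)
    (hKm.inter (measurableSet_inner_nonneg u q))
    (fun v ↦ hKm.inter (measurableSet_inner_nonneg v q)) hKm hKfin
    (.of_forall fun v ↦ Set.inter_subset_left) ?_
  have hae : ∀ᵐ z : E, ⟪u, z - q⟫_ℝ ≠ 0 := by
    rw [ae_iff]
    simpa using volume_inner_sub_eq_zero hu q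
  filter_upwards [hae] with z hz
  have hc : Continuous fun v : E ↦ ⟪v, z - q⟫_ℝ := by fun_prop
  rcases hz.lt_or_gt with h | h
  · filter_upwards [hc.continuousAt.eventually_lt_const h] with v hv
    simp [hv.not_ge, h.not_ge]
  · filter_upwards [hc.continuousAt.eventually_const_lt h] with v hv
    simp [hv.le, h.le]

/-- A ray issuing from a point of a bounded open convex set leaves it at exactly one point. -/
lemma exists_mem_frontier_ray {E : Type*} [NormedAddCommGroup E] [NormedSpace ℝ E] {K : Set E}
    (hKo : IsOpen K) (hKc : Convex ℝ K) (hKb : IsBounded K) {q w : E} (hq : q ∈ K) (hw : w ≠ 0) :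
    ∃ s : ℝ, 0 < s ∧ q + s • w ∈ frontier K ∧ (∀ x, 0 ≤ x → x < s → q + x • w ∈ K) ∧
      ∀ x, s < x → q + x • w ∉ closure K := by
  have hcont : Continuous fun x : ℝ ↦ q + x • w := by fun_prop
  obtain ⟨R, hR⟩ := hKb.subset_closedBall q
  have hw' : 0 < ‖w‖ := norm_pos_iff.mpr hw
  have hout : q + ((|R| + 1) / ‖w‖) • w ∉ K := fun h ↦ by
    have := hR h
    rw [mem_closedBall, dist_eq_norm, add_sub_cancel_left, norm_smul, Real.norm_of_nonneg
      (by positivity), div_mul_cancel₀ _ hw'.ne'] at this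
    linarith [le_abs_self R]
  obtain ⟨_, ⟨s, hs, rfl⟩, hsf⟩ : (((fun x : ℝ ↦ q + x • w) '' Set.Ici 0) ∩ frontier K).Nonempty := by
    by_contra! hempty
    refine hout ((isPreconnected_Ici.image _ hcont.continuousOn).subset_of_closure_inter_subset hKo
      ⟨q, ⟨0, Set.self_mem_Ici, by simp⟩, hq⟩ (fun z hz ↦ ?_)
      ⟨(|R| + 1) / ‖w‖, Set.mem_Ici.mpr (by positivity), rfl⟩)
    by_contra hzK
    exact (hempty ▸ ⟨hz.2, hKo.frontier_eq ▸ ⟨hz.1, hzK⟩⟩ : z ∈ (∅ : Set E))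
  have hsK : q + s • w ∉ K := (hKo.frontier_eq ▸ hsf).2
  have hs0 : 0 < s := lt_of_le_of_ne hs fun h ↦ hsK (by simpa [← h] using hq)
  have key : ∀ x y : ℝ, 0 ≤ x → x < y → q + y • w ∈ closure K → q + x • w ∈ K := by
    intro x y hx hxy hy
    have hy0 : 0 < y := hx.trans_lt hxy
    have := hKc.combo_interior_closure_mem_interior (x := q) (y := q + y • w)
      (hKo.interior_eq.symm ▸ hq) hy (a := 1 - x / y) (b := x / y)
      (by rw [sub_pos, div_lt_one hy0]; exact hxy) (by positivity) (by ring)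
    rw [hKo.interior_eq] at this
    convert this using 1
    rw [smul_add, smul_smul, div_mul_cancel₀ _ hy0.ne', sub_smul, one_smul]
    abel
  exact ⟨s, hs0, hsf, fun x hx hxs ↦ key x s hx hxs hsf.1, fun x hx h ↦ hsK (key s x hs hx h)⟩

/-- If `q` is closer to the end of the chord in direction `-w` than to the one in direction `w`,
then tilting the halfspace about `q` strictly decreases the area it cuts off. -/
lemma exists_volume_inter_halfspace_lt {E : Type*} [NormedAddCommGroup E] [InnerProductSpace ℝ E]
    [FiniteDimensional ℝ E] [MeasurableSpace E] [BorelSpace E] {K : Set E}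
    (hKo : IsOpen K) (hKb : IsBounded K) {q v w : E} (hv : ‖v‖ = 1) (hw : ‖w‖ = 1)
    (hvw : ⟪v, w⟫_ℝ = 0) (hspan : ∀ z, ⟪v, z⟫_ℝ = 0 → z = ⟪w, z⟫_ℝ • w) {s t : ℝ} (ht : 0 ≤ t)
    (hts : t < s) (hin : ∀ x, 0 ≤ x → x < s → q + x • w ∈ K)
    (hout : ∀ x, t < x → q + x • (-w) ∉ closure K) :
    ∃ u : E, u ≠ 0 ∧ volume (K ∩ {z | 0 ≤ ⟪u, z - q⟫_ℝ}) <
      volume (K ∩ {z | 0 ≤ ⟪v, z - q⟫_ℝ}) := by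
  have hKfin : volume K ≠ ⊤ := hKb.measure_lt_top.ne
  have hwv : ⟪w, v⟫_ℝ = 0 := by rw [real_inner_comm]; exact hvw
  have hvv : ⟪v, v⟫_ℝ = 1 := by simp [hv]
  have hww : ⟪w, w⟫_ℝ = 1 := by simp [hw]
  set X : E → ℝ := fun z ↦ ⟪w, z - q⟫_ℝ with hX
  set Y : E → ℝ := fun z ↦ ⟪v, z - q⟫_ℝ with hY
  have hXc : Continuous X := by fun_prop
  have hYc : Continuous Y := by fun_prop
  set R : E → E := fun z ↦ (q + q) - z with hR
  have hRmp : MeasurePreserving R volume volume := Measure.measurePreserving_sub_left volume (q + q)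
  have hRc : Continuous R := by fun_prop
  have hXR : ∀ z, X (R z) = - X z := fun z ↦ by
    simp only [hX, hR, ← inner_neg_right]; congr 1; abel
  have hYR : ∀ z, Y (R z) = - Y z := fun z ↦ by
    simp only [hY, hR, ← inner_neg_right]; congr 1; abel
  have hcomp : IsCompact (R ⁻¹' closure K ∩ Kᶜ) :=
    (((Homeomorph.subLeft (q + q)).isCompact_preimage).mpr hKb.isCompact_closure).inter_right
      hKo.isClosed_compl
  have hpos : ∀ z ∈ R ⁻¹' closure K ∩ Kᶜ, 0 < max |Y z| (-X z) := by
    rintro z ⟨hz1, hz2⟩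
    by_contra! h
    have hy : Y z = 0 := abs_nonpos_iff.mp ((le_max_left _ _).trans h)
    have hx : 0 ≤ X z := by linarith [(le_max_right |Y z| (-X z)).trans h]
    have hzq : z = q + X z • w := by rw [← hspan _ hy]; abel
    by_cases hxt : X z ≤ t
    · exact hz2 (hzq ▸ hin _ hx (hxt.trans_lt hts))
    · refine hout _ (not_le.mp hxt) ?_
      convert Set.mem_preimage.mp hz1 using 1
      simp only [hR]
      nth_rewrite 2 [hzq]
      rw [smul_neg]; abel
  obtain ⟨ε, hε, hεC⟩ : ∃ ε > 0, ∀ z ∈ R ⁻¹' closure K ∩ Kᶜ, ε ≤ max |Y z| (-X z) :=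
    hcomp.exists_forall_le' (by fun_prop) hpos
  obtain ⟨M, hM⟩ := hcomp.exists_bound_of_continuousOn hXc.continuousOn
  set m : ℝ := ε / (|M| + 1) with hm
  have hm0 : 0 < m := by positivity
  have hmM : m * |M| < ε := by
    rw [hm, div_mul_eq_mul_div, div_lt_iff₀ (by positivity)]; nlinarith
  have hwedge : ∀ z, R z ∈ closure K → 0 < Y z → Y z ≤ m * X z → z ∈ K := by
    intro z hz hy0 hy
    by_contra hzK
    have hx0 : 0 < X z := by
      by_contra! h
      nlinarith
    have h1 := hεC z ⟨hz, hzK⟩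
    have h2 := (le_abs_self _).trans ((hM z ⟨hz, hzK⟩).trans (le_abs_self M))
    rcases le_max_iff.mp h1 with h | h
    · rw [abs_of_pos hy0] at h
      nlinarith
    · linarith
  set u : E := v - m • w with hu
  have hZ : ∀ z, ⟪u, z - q⟫_ℝ = Y z - m * X z := fun z ↦ by
    simp only [hu, hX, hY, inner_sub_left, real_inner_smul_left]
  have hu0 : u ≠ 0 := by
    intro h
    have : ⟪v, u⟫_ℝ = 1 := by rw [hu, inner_sub_right, real_inner_smul_right, hvv, hvw]; simp
    simp [h] at this
  refine ⟨u, hu0, ?_⟩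
  set A : Set E := K ∩ {z | 0 ≤ Y z} with hA
  set B : Set E := K ∩ {z | 0 ≤ ⟪u, z - q⟫_ℝ} with hB
  have hAm : MeasurableSet A := hKo.measurableSet.inter (measurableSet_inner_nonneg v q)
  have hBm : MeasurableSet B := hKo.measurableSet.inter (measurableSet_inner_nonneg u q)
  set W : Set E := {z | 0 < Y z ∧ Y z < m * X z} with hW
  have hWo : IsOpen W :=
    (isOpen_lt continuous_const hYc).inter (isOpen_lt hYc (continuous_const.mul hXc))
  set D : Set E := K ∩ W ∩ (R ⁻¹' closure K)ᶜ with hD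
  have hDo : IsOpen D := (hKo.inter hWo).inter (isClosed_closure.preimage hRc).isOpen_compl
  have hDne : D.Nonempty := by
    set r : ℝ := (s + t) / 2 with hr
    have hrt : t < r := by rw [hr]; linarith
    have hopen : IsOpen (K ∩ (R ⁻¹' closure K)ᶜ) :=
      hKo.inter (isClosed_closure.preimage hRc).isOpen_compl
    have hmem : q + r • w + (0 : ℝ) • v ∈ K ∩ (R ⁻¹' closure K)ᶜ := by
      rw [zero_smul, add_zero]
      refine ⟨hin r (ht.trans hrt.le) (by rw [hr]; linarith), fun h ↦ hout r hrt ?_⟩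
      convert Set.mem_preimage.mp h using 1
      simp only [hR]
      rw [smul_neg]; abel
    have hc : Continuous fun y : ℝ ↦ q + r • w + y • v := by fun_prop
    have hev : ∀ᶠ y in nhdsWithin (0 : ℝ) (Set.Ioi 0),
        q + r • w + y • v ∈ K ∩ (R ⁻¹' closure K)ᶜ :=
      nhdsWithin_le_nhds (hc.continuousAt.eventually_mem (hopen.mem_nhds hmem))
    have hev' : ∀ᶠ y in nhdsWithin (0 : ℝ) (Set.Ioi 0), y ∈ Set.Ioo 0 (m * r) :=
      Ioo_mem_nhdsGT (by have := ht.trans_lt hrt; positivity)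
    obtain ⟨y, hy, hy0, hym⟩ := (hev.and hev').exists
    have e : q + r • w + y • v - q = r • w + y • v := by abel
    have hyX : X (q + r • w + y • v) = r := by
      simp only [hX]
      rw [e, inner_add_right, real_inner_smul_right, real_inner_smul_right, hww, hwv]; simp
    have hyY : Y (q + r • w + y • v) = y := by
      simp only [hY]
      rw [e, inner_add_right, real_inner_smul_right, real_inner_smul_right, hvv, hvw]; simp
    refine ⟨_, ⟨hy.1, ?_⟩, hy.2⟩
    simp only [hW, Set.mem_ofPred_eq, hyX, hyY]
    exact ⟨hy0, hym⟩
  have hDpos : 0 < volume D := hDo.measure_pos volume hDne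
  have hgain : volume (B \ A) ≤ volume (K ∩ W ∩ R ⁻¹' closure K) := by
    rw [← hRmp.measure_preimage (hBm.diff hAm).nullMeasurableSet]
    calc volume (R ⁻¹' (B \ A))
        ≤ volume ((K ∩ W ∩ R ⁻¹' closure K) ∪ {z | ⟪u, z - q⟫_ℝ = 0}) := by
          refine measure_mono fun z hz ↦ ?_
          obtain ⟨⟨hzK, hzB⟩, hzA⟩ := hz
          have hy : 0 < Y z := by
            by_contra! h
            exact hzA ⟨hzK, by simp only [Set.mem_ofPred_eq, hYR]; linarith⟩
          simp only [Set.mem_ofPred_eq, hZ, hXR, hYR] at hzB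
          have hle : Y z ≤ m * X z := by linarith
          rcases hle.eq_or_lt with h | h
          · right
            simp only [Set.mem_ofPred_eq, hZ]; linarith
          · left
            exact ⟨⟨hwedge z (subset_closure hzK) hy hle, hy, h⟩, subset_closure hzK⟩
      _ ≤ volume (K ∩ W ∩ R ⁻¹' closure K) + volume {z | ⟪u, z - q⟫_ℝ = 0} :=
          measure_union_le _ _
      _ = _ := by rw [volume_inner_sub_eq_zero hu0, add_zero]
  have hloss : volume (K ∩ W ∩ R ⁻¹' closure K) + volume D ≤ volume (A \ B) := by
    rw [hD, ← Set.sdiff_eq, measure_inter_add_sdiff _ (isClosed_closure.preimage hRc).measurableSet]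
    refine measure_mono fun z hz ↦ ⟨⟨hz.1, hz.2.1.le⟩, fun h ↦ ?_⟩
    have := h.2
    simp only [Set.mem_ofPred_eq, hZ] at this
    linarith [hz.2.2]
  have hfin : ∀ S ⊆ K, volume S ≠ ⊤ := fun S hS ↦ measure_ne_top_of_subset hS hKfin
  have hlt : volume (B \ A) < volume (A \ B) :=
    hgain.trans_lt ((ENNReal.lt_add_right (hfin _ fun z hz ↦ hz.1.1) hDpos.ne').trans_le hloss)
  rw [← measure_inter_add_sdiff A hBm, ← measure_inter_add_sdiff B hAm, Set.inter_comm B A]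
  exact ENNReal.add_lt_add_left (hfin _ fun z hz ↦ hz.1.1) hlt

lemma exists_orthonormal_plane {v : EuclideanSpace ℝ (Fin 2)} (hv : ‖v‖ = 1) :
    ∃ w : EuclideanSpace ℝ (Fin 2), ‖w‖ = 1 ∧ ⟪v, w⟫_ℝ = 0 ∧
      ∀ z, ⟪v, z⟫_ℝ = 0 → z = ⟪w, z⟫_ℝ • w := by
  have hv2 : v 0 ^ 2 + v 1 ^ 2 = 1 := by
    have := EuclideanSpace.real_norm_sq_eq v
    rw [hv, Fin.sum_univ_two] at this
    linarith
  refine ⟨!₂[-v 1, v 0], ?_, ?_, fun z hz ↦ ?_⟩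
  · rw [EuclideanSpace.norm_eq, Real.sqrt_eq_one, Fin.sum_univ_two]
    simp; linarith
  · simp [PiLp.inner_apply, Fin.sum_univ_two]; ring
  · simp only [PiLp.inner_apply, Fin.sum_univ_two, RCLike.inner_apply, conj_trivial] at hz
    ext i
    fin_cases i <;> simp [PiLp.inner_apply, Fin.sum_univ_two]
    · linear_combination (-z 0) * hv2 + v 0 * hz
    · linear_combination (-z 1) * hv2 + v 1 * hz

theorem stmt14 (K : Set (EuclideanSpace ℝ (Fin 2)))
    (hKne : K.Nonempty) (hKbdd : IsBounded K)
    (hpoly : ∃ (n : ℕ) (u : Fin n → EuclideanSpace ℝ (Fin 2)) (c : Fin n → ℝ),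
        (∀ i, u i ≠ 0) ∧ K = ⋂ i, {z | ⟪u i, z⟫_ℝ < c i})
    (q : EuclideanSpace ℝ (Fin 2)) (hq : q ∈ K) :
    ∃ v : EuclideanSpace ℝ (Fin 2), ‖v‖ = 1 ∧
      (∃ a b : EuclideanSpace ℝ (Fin 2), a ∈ frontier K ∧ b ∈ frontier K ∧
        ⟪v, a - q⟫_ℝ = 0 ∧ ⟪v, b - q⟫_ℝ = 0 ∧ a ≠ b ∧ q = midpoint ℝ a b) ∧
      (volume (K ∩ {z | 0 ≤ ⟪v, z - q⟫_ℝ})).toReal =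
        halfspaceDepth K q * (volume K).toReal := by
  obtain ⟨n, f, c, -, hK⟩ := hpoly
  have hKo : IsOpen K := by
    rw [hK]
    exact isOpen_iInter_of_finite fun i ↦ isOpen_lt (by fun_prop) continuous_const
  have hKc : Convex ℝ K := by
    rw [hK]
    exact convex_iInter fun i ↦ convex_halfSpace_lt (innerₛₗ ℝ (f i)).isLinear _
  have hKfin : volume K ≠ ⊤ := hKbdd.measure_lt_top.ne
  have hKpos : 0 < (volume K).toReal :=
    ENNReal.toReal_pos (hKo.measure_pos volume hKne).ne' hKfin
  obtain ⟨v, hvS, hmin⟩ := (isCompact_sphere (0 : EuclideanSpace ℝ (Fin 2)) 1).exists_isMinOn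
    (NormedSpace.sphere_nonempty.mpr zero_le_one)
    (f := fun v ↦ volume (K ∩ {z | 0 ≤ ⟪v, z - q⟫_ℝ})) fun v hv ↦
      (continuousAt_volume_inter_halfspace hKo.measurableSet hKfin q
        (ne_zero_of_mem_unit_sphere ⟨v, hv⟩)).continuousWithinAt
  have hv : ‖v‖ = 1 := by simpa using hvS
  have hle : ∀ u : EuclideanSpace ℝ (Fin 2), u ≠ 0 →
      volume (K ∩ {z | 0 ≤ ⟪v, z - q⟫_ℝ}) ≤ volume (K ∩ {z | 0 ≤ ⟪u, z - q⟫_ℝ}) := by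
    intro u hu
    have hmem : ‖u‖⁻¹ • u ∈ sphere (0 : EuclideanSpace ℝ (Fin 2)) 1 := by
      simp [norm_smul, hu]
    have h := hmin hmem
    simpa only [Set.mem_ofPred_eq, real_inner_smul_left,
      mul_nonneg_iff_of_pos_left (inv_pos.mpr (norm_pos_iff.mpr hu))] using h
  obtain ⟨w, hw, hvw, hspan⟩ := exists_orthonormal_plane hv
  have hw0 : w ≠ 0 := norm_ne_zero_iff.mp (by simp [hw])
  obtain ⟨s, hs, hsf, hsin, hsout⟩ := exists_mem_frontier_ray hKo hKc hKbdd hq hw0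
  obtain ⟨t, ht, htf, htin, htout⟩ := exists_mem_frontier_ray hKo hKc hKbdd hq (neg_ne_zero.mpr hw0)
  have hst : s = t := by
    rcases lt_trichotomy t s with h | h | h
    · obtain ⟨u, hu, hlt⟩ := exists_volume_inter_halfspace_lt hKo hKbdd hv hw hvw hspan ht.le h
        hsin htout
      exact absurd (hle u hu) hlt.not_ge
    · exact h.symm
    · obtain ⟨u, hu, hlt⟩ := exists_volume_inter_halfspace_lt hKo hKbdd hv
        (w := -w) (by simpa using hw) (by simpa using hvw)
        (fun z hz ↦ by simpa using hspan z hz) hs.le h htin (by simpa using hsout)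
      exact absurd (hle u hu) hlt.not_ge
  subst hst
  refine ⟨v, hv, ⟨q + s • w, q + s • (-w), hsf, htf, ?_, ?_, fun h ↦ ?_, ?_⟩, ?_⟩
  · simp [real_inner_smul_right, hvw]
  · simp [real_inner_smul_right, hvw]
  · have h2 : s = s * -1 := smul_left_injective ℝ hw0 (by simpa [mul_smul] using h)
    linarith
  · rw [midpoint_eq_smul_add, smul_neg, add_add_add_comm, add_neg_cancel, add_zero, ← two_smul ℝ q,
      smul_smul]
    simp
  · have hdepth : halfspaceDepth K q =
        (volume (K ∩ {z | 0 ≤ ⟪v, z - q⟫_ℝ})).toReal / (volume K).toReal := by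
      have : Nonempty {v : EuclideanSpace ℝ (Fin 2) // ‖v‖ = 1} := ⟨⟨v, hv⟩⟩
      refine le_antisymm (ciInf_le (f := fun v : {v : EuclideanSpace ℝ (Fin 2) // ‖v‖ = 1} ↦
        (volume {z | z ∈ K ∧ 0 ≤ ⟪(v : EuclideanSpace ℝ (Fin 2)), z - q⟫_ℝ}).toReal
          / (volume K).toReal) ⟨0, ?_⟩ ⟨v, hv⟩) (le_ciInf fun u ↦ ?_)
      · rintro _ ⟨u, rfl⟩
        positivity
      · exact div_le_div_of_nonneg_right (ENNReal.toReal_mono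
          (measure_ne_top_of_subset (fun z hz ↦ hz.1) hKfin)
          (hle u (norm_ne_zero_iff.mp (by simp [u.2])))) hKpos.le
    rw [hdepth, div_mul_cancel₀ _ hKpos.ne']
end

section
/- Let K ⊂ ℝ² be a nonempty bounded open convex set contained in the closed slab between two distinct parallel lines ℓ₁ and ℓ₂. Let P, Q ∈ ℓ₁ and R, E ∈ ℓ₂ be points in the closure of K, and let q be a point that is simultaneously the midpoint of the segment [P,R] and the midpoint of the segment [Q,E]. Assume Q does not lie on the line through P and R. Then the area of K intersected with the open halfplane bounded by the line through P and R that contains Q equals the area of K intersected with the open halfplane bounded by the line through Q and E that contains R. -/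
open MeasureTheory Metric Bornology
open scoped InnerProductSpace Pointwise

def cross2 (u w : EuclideanSpace ℝ (Fin 2)) : ℝ := u 0 * w 1 - u 1 * w 0

/-- The linear involution sending `u` to `-v` and `v` to `-u`. -/
noncomputable def negSwap (u v : EuclideanSpace ℝ (Fin 2)) :
    EuclideanSpace ℝ (Fin 2) →ₗ[ℝ] EuclideanSpace ℝ (Fin 2) where
  toFun z := -((cross2 u z / cross2 u v) • u + (cross2 z v / cross2 u v) • v)
  map_add' a b := by
    ext i
    simp only [cross2, PiLp.add_apply, PiLp.neg_apply, PiLp.smul_apply, smul_eq_mul]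
    ring
  map_smul' c a := by
    ext i
    simp only [cross2, PiLp.add_apply, PiLp.neg_apply, PiLp.smul_apply, smul_eq_mul,
      RingHom.id_apply]
    ring

section cross2

variable {u v : EuclideanSpace ℝ (Fin 2)}

lemma eq_cross2_smul_add_smul (h : cross2 u v ≠ 0) (z : EuclideanSpace ℝ (Fin 2)) :
    z = (cross2 z v / cross2 u v) • u + (cross2 u z / cross2 u v) • v := by
  ext i
  simp only [PiLp.add_apply, PiLp.smul_apply, smul_eq_mul]
  field_simp
  fin_cases i <;> simp [cross2] <;> ring

lemma cross2_negSwap_right (h : cross2 u v ≠ 0) (z : EuclideanSpace ℝ (Fin 2)) :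
    cross2 u (negSwap u v z) = -cross2 z v := by
  have : cross2 u (negSwap u v z) = -(cross2 z v / cross2 u v * cross2 u v) := by
    simp only [negSwap, LinearMap.coe_mk, AddHom.coe_mk, cross2, PiLp.add_apply, PiLp.neg_apply,
      PiLp.smul_apply, smul_eq_mul]
    ring
  rw [this, div_mul_cancel₀ _ h]

lemma cross2_negSwap_left (h : cross2 u v ≠ 0) (z : EuclideanSpace ℝ (Fin 2)) :
    cross2 (negSwap u v z) v = -cross2 u z := by
  have : cross2 (negSwap u v z) v = -(cross2 u z / cross2 u v * cross2 u v) := by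
    simp only [negSwap, LinearMap.coe_mk, AddHom.coe_mk, cross2, PiLp.add_apply, PiLp.neg_apply,
      PiLp.smul_apply, smul_eq_mul]
    ring
  rw [this, div_mul_cancel₀ _ h]

lemma negSwap_negSwap (h : cross2 u v ≠ 0) (z : EuclideanSpace ℝ (Fin 2)) :
    negSwap u v (negSwap u v z) = z := by
  conv_rhs => rw [eq_cross2_smul_add_smul h z]
  change -((cross2 u (negSwap u v z) / cross2 u v) • u
    + (cross2 (negSwap u v z) v / cross2 u v) • v) = _
  rw [cross2_negSwap_left h, cross2_negSwap_right h]
  module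

lemma abs_det_negSwap (h : cross2 u v ≠ 0) : |LinearMap.det (negSwap u v)| = 1 := by
  have hsq : LinearMap.det (negSwap u v) * LinearMap.det (negSwap u v) = 1 := by
    have hcomp : negSwap u v ∘ₗ negSwap u v = LinearMap.id := by
      refine LinearMap.ext fun z => ?_
      rw [LinearMap.comp_apply, negSwap_negSwap h, LinearMap.id_apply]
    rw [← LinearMap.det_comp, hcomp, LinearMap.det_id]
  rcases mul_self_eq_one_iff.mp hsq with h1 | h1 <;> simp [h1]

lemma volume_preimage_negSwap (h : cross2 u v ≠ 0) (q : EuclideanSpace ℝ (Fin 2))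
    (s : Set (EuclideanSpace ℝ (Fin 2))) :
    volume ((fun z => negSwap u v (z - q) + q) ⁻¹' s) = volume s := by
  have hdet := abs_det_negSwap h
  have hne : LinearMap.det (negSwap u v) ≠ 0 := by
    intro h0
    simp [h0] at hdet
  calc volume ((fun z => negSwap u v (z - q) + q) ⁻¹' s)
      = volume ((fun z => z + -q) ⁻¹' (negSwap u v ⁻¹' ((fun z => z + q) ⁻¹' s))) := by
        simp only [← sub_eq_add_neg]; rfl
    _ = volume s := by
        rw [measure_preimage_add_right, Measure.addHaar_preimage_linearMap _ hne, abs_inv, hdet,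
          measure_preimage_add_right]
        simp

end cross2

/-- An open set lying in a closed halfspace lies in its interior. -/
lemma IsOpen.inner_lt_of_forall_inner_le {E : Type*} [NormedAddCommGroup E]
    [InnerProductSpace ℝ E] {K : Set E} (hK : IsOpen K) {n : E} (hn : n ≠ 0) {c : ℝ}
    (h : ∀ z ∈ K, ⟪n, z⟫_ℝ ≤ c) {z : E} (hz : z ∈ K) : ⟪n, z⟫_ℝ < c := by
  have hcont : Continuous fun t : ℝ => z + t • n := by fun_prop
  have hmem : ∀ᶠ t in nhdsWithin (0 : ℝ) (Set.Ioi 0), z + t • n ∈ K :=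
    (hcont.continuousAt.eventually (hK.mem_nhds (by simpa using hz))).filter_mono
      nhdsWithin_le_nhds
  obtain ⟨t, htK, ht⟩ := (hmem.and self_mem_nhdsWithin).exists
  have hle := h _ htK
  rw [inner_add_right, inner_smul_right] at hle
  have hpos : 0 < t * ⟪n, n⟫_ℝ := mul_pos ht (real_inner_self_pos.mpr hn)
  linarith

/-- A convex set containing the vertices `q ± u`, `q ± v` contains the parallelogram they span. -/
lemma Convex.add_smul_add_smul_mem {E : Type*} [AddCommGroup E] [Module ℝ E] {C : Set E}
    (hC : Convex ℝ C) {q u v : E} (hu : q + u ∈ C) (hu' : q - u ∈ C) (hv : q + v ∈ C)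
    (hv' : q - v ∈ C) {x y : ℝ} (hs : |x + y| ≤ 1) (hd : |x - y| ≤ 1) :
    q + (x • u + y • v) ∈ C := by
  rw [abs_le] at hs hd
  have hside := hC hu hv (a := (1 + (x - y)) / 2) (b := (1 - (x - y)) / 2)
    (by linarith) (by linarith) (by ring)
  have hside' := hC hv' hu' (a := (1 + (x - y)) / 2) (b := (1 - (x - y)) / 2)
    (by linarith) (by linarith) (by ring)
  have hz := hC hside hside' (a := (1 + (x + y)) / 2) (b := (1 - (x + y)) / 2)
    (by linarith) (by linarith) (by ring)
  convert hz using 1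
  module

theorem stmt16 (K : Set (EuclideanSpace ℝ (Fin 2)))
    (hKne : K.Nonempty) (hKopen : IsOpen K) (hKbdd : IsBounded K) (hKconv : Convex ℝ K)
    (n : EuclideanSpace ℝ (Fin 2)) (hn : n ≠ 0) (c₁ c₂ : ℝ) (hc : c₁ ≠ c₂)
    (hslab : K ⊆ {z | min c₁ c₂ ≤ ⟪n, z⟫_ℝ ∧ ⟪n, z⟫_ℝ ≤ max c₁ c₂})
    (P Q R S : EuclideanSpace ℝ (Fin 2))
    (hP : ⟪n, P⟫_ℝ = c₁) (hQ : ⟪n, Q⟫_ℝ = c₁) (hR : ⟪n, R⟫_ℝ = c₂) (hS : ⟪n, S⟫_ℝ = c₂)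
    (hPc : P ∈ closure K) (hQc : Q ∈ closure K) (hRc : R ∈ closure K) (hSc : S ∈ closure K)
    (q : EuclideanSpace ℝ (Fin 2)) (hq1 : q = midpoint ℝ P R) (hq2 : q = midpoint ℝ Q S)
    (hQside : cross2 (R - P) (Q - P) ≠ 0) :
    volume (K ∩ {z | 0 < cross2 (R - P) (Q - P) * cross2 (R - P) (z - P)}) =
      volume (K ∩ {z | 0 < cross2 (S - Q) (R - Q) * cross2 (S - Q) (z - Q)}) := by
  obtain ⟨u, rfl⟩ : ∃ u, P = q + u := ⟨P - q, by abel⟩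
  obtain ⟨v, rfl⟩ : ∃ v, Q = q + v := ⟨Q - q, by abel⟩
  obtain rfl : R = q - u := by
    have h2 : (2 : ℝ) • q = (q + u) + R := by
      conv_lhs => rw [hq1, midpoint_eq_smul_add]
      simp
    rw [two_smul, add_assoc, add_left_cancel_iff] at h2
    exact eq_sub_of_add_eq' h2.symm
  obtain rfl : S = q - v := by
    have h2 : (2 : ℝ) • q = (q + v) + S := by
      conv_lhs => rw [hq2, midpoint_eq_smul_add]
      simp
    rw [two_smul, add_assoc, add_left_cancel_iff] at h2
    exact eq_sub_of_add_eq' h2.symm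
  clear hq1 hq2
  have hside (z : EuclideanSpace ℝ (Fin 2)) :
      cross2 (q - u - (q + u)) (z - (q + u)) = -2 * cross2 u (z - q) := by
    simp only [cross2, PiLp.add_apply, PiLp.sub_apply]; ring
  have hside' (z : EuclideanSpace ℝ (Fin 2)) :
      cross2 (q - v - (q + v)) (z - (q + v)) = 2 * cross2 (z - q) v := by
    simp only [cross2, PiLp.add_apply, PiLp.sub_apply]; ring
  have hneg : cross2 (q - u - q) v = -cross2 u v := by
    simp only [cross2, PiLp.sub_apply]; ring
  simp only [hside, hside', hneg, add_sub_cancel_left] at hQside ⊢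
  have hD : cross2 u v ≠ 0 := fun h => hQside (by simp [h])
  set x : EuclideanSpace ℝ (Fin 2) → ℝ := fun z => cross2 (z - q) v / cross2 u v with hx
  set y : EuclideanSpace ℝ (Fin 2) → ℝ := fun z => cross2 u (z - q) / cross2 u v with hy
  have hdecomp (z : EuclideanSpace ℝ (Fin 2)) : z = q + (x z • u + y z • v) := by
    rw [← eq_cross2_smul_add_smul hD (z - q)]; abel
  have hD2 : 0 < 4 * cross2 u v ^ 2 := by positivity
  have hY : {z | 0 < -2 * cross2 u v * (-2 * cross2 u (z - q))} = {z | 0 < y z} := by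
    ext z
    have : -2 * cross2 u v * (-2 * cross2 u (z - q)) = 4 * cross2 u v ^ 2 * y z := by
      simp only [hy]; field_simp; ring
    simp only [Set.mem_ofPred_eq, this, mul_pos_iff_of_pos_left hD2]
  have hX : {z | 0 < 2 * -cross2 u v * (2 * cross2 (z - q) v)} = {z | x z < 0} := by
    ext z
    have : 2 * -cross2 u v * (2 * cross2 (z - q) v) = 4 * cross2 u v ^ 2 * -x z := by
      simp only [hx]; field_simp; ring
    simp only [Set.mem_ofPred_eq, this, mul_pos_iff_of_pos_left hD2, neg_pos]
  rw [hX, hY]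
  have hxc : Continuous x := by simp only [hx, cross2, PiLp.sub_apply]; fun_prop
  have hyc : Continuous y := by simp only [hy, cross2, PiLp.sub_apply]; fun_prop
  have hmem (z : EuclideanSpace ℝ (Fin 2)) (hs : |x z + y z| < 1) (hd : |x z - y z| < 1) :
      z ∈ K := by
    have hopen : IsOpen {w | |x w + y w| < 1 ∧ |x w - y w| < 1} :=
      IsOpen.and (isOpen_lt (hxc.add hyc).abs continuous_const)
        (isOpen_lt (hxc.sub hyc).abs continuous_const)
    have hsub : {w | |x w + y w| < 1 ∧ |x w - y w| < 1} ⊆ closure K := fun w hw => by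
      rw [hdecomp w]
      exact hKconv.closure.add_smul_add_smul_mem hPc hRc hQc hSc hw.1.le hw.2.le
    have hint : interior (closure K) = K := by
      rw [hKconv.interior_closure_eq_interior_of_nonempty_interior
        (by rwa [hKopen.interior_eq]), hKopen.interior_eq]
    exact hint ▸ interior_maximal hsub hopen ⟨hs, hd⟩
  have hslab' (z : EuclideanSpace ℝ (Fin 2)) (hz : z ∈ K) : |x z + y z| < 1 := by
    have hlt := hKopen.inner_lt_of_forall_inner_le hn (fun w hw => (hslab hw).2) hz
    have hgt := hKopen.inner_lt_of_forall_inner_le (neg_ne_zero.mpr hn) (c := -min c₁ c₂)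
      (fun w hw => by rw [inner_neg_left]; exact neg_le_neg (hslab hw).1) hz
    rw [inner_neg_left, neg_lt_neg_iff] at hgt
    have hinner : ⟪n, z⟫_ℝ = ⟪n, q⟫_ℝ + (x z * ⟪n, u⟫_ℝ + y z * ⟪n, v⟫_ℝ) := by
      conv_lhs => rw [hdecomp z]
      simp only [inner_add_right, inner_smul_right]
    rw [inner_add_right] at hP hQ
    rw [inner_sub_right] at hR
    have hv : ⟪n, v⟫_ℝ = (c₁ - c₂) / 2 := by linarith
    have hu : ⟪n, u⟫_ℝ = (c₁ - c₂) / 2 := by linarith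
    have hq : ⟪n, q⟫_ℝ = (c₁ + c₂) / 2 := by linarith
    rw [hinner, hu, hv, hq] at hlt hgt
    rw [abs_lt]
    rcases lt_or_gt_of_ne hc with h | h
    · rw [max_eq_right h.le] at hlt
      rw [min_eq_left h.le] at hgt
      constructor <;> nlinarith
    · rw [max_eq_left h.le] at hlt
      rw [min_eq_right h.le] at hgt
      constructor <;> nlinarith
  have hxg (z : EuclideanSpace ℝ (Fin 2)) : x (negSwap u v (z - q) + q) = -y z := by
    simp only [hx, hy, add_sub_cancel_right, cross2_negSwap_left hD, neg_div]
  have hyg (z : EuclideanSpace ℝ (Fin 2)) : y (negSwap u v (z - q) + q) = -x z := by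
    simp only [hx, hy, add_sub_cancel_right, cross2_negSwap_right hD, neg_div]
  have hpre : (fun z => negSwap u v (z - q) + q) ⁻¹' ((K ∩ {z | x z < 0}) \ {z | 0 < y z}) =
      (K ∩ {z | 0 < y z}) \ {z | x z < 0} := by
    ext z
    simp only [Set.mem_preimage, Set.mem_sdiff, Set.mem_inter_iff, Set.mem_ofPred_eq, hxg, hyg,
      not_lt, neg_lt_zero, neg_nonpos]
    constructor
    · rintro ⟨⟨hK, hy0⟩, hx0⟩
      have h1 := abs_lt.mp (hslab' _ hK)
      rw [hxg, hyg] at h1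
      exact ⟨⟨hmem z (abs_lt.mpr ⟨by linarith, by linarith⟩)
        (abs_lt.mpr ⟨by linarith, by linarith⟩), hy0⟩, hx0⟩
    · rintro ⟨⟨hK, hy0⟩, hx0⟩
      have h1 := abs_lt.mp (hslab' _ hK)
      refine ⟨⟨hmem _ ?_ ?_, hy0⟩, hx0⟩ <;> rw [hxg, hyg, abs_lt] <;>
        constructor <;> linarith
  have hXm : MeasurableSet {z | x z < 0} := (isOpen_lt hxc continuous_const).measurableSet
  have hYm : MeasurableSet {z | 0 < y z} := (isOpen_lt continuous_const hyc).measurableSet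
  rw [← measure_inter_add_sdiff (K ∩ {z | 0 < y z}) hXm,
    ← measure_inter_add_sdiff (K ∩ {z | x z < 0}) hYm, ← hpre, volume_preimage_negSwap hD,
    Set.inter_right_comm]
end
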